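/- Let M⁺ and M⁻ be nonsingular symmetric n×n real matrices, and let N⁺ and N⁻ be nonsingular symmetric (n+1)×(n+1) real matrices whose leading principal n×n submatrices (obtained by deleting the last row and column) are M⁺ and M⁻ respectively. Suppose det(N⁻) = 2·det(M⁻). Then (σ(M⁺) − σ(M⁻)) − (σ(N⁺) − σ(N⁻)) = 1 − sign(det(M⁺)·det(N⁺)); in particular this difference equals 0 or 2. -/

import Mathlib

open Matrix

/-- The sign of a real number, as an integer. -/
noncomputable def sgn (x : ℝ) : ℤ :=
  if 0 < x then 1 else if x < 0 then -1 else 0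

/-- The signature of a real symmetric (Hermitian) matrix: the number of positive
eigenvalues minus the number of negative eigenvalues, counted with multiplicity
(junk value 0 if the matrix is not Hermitian). -/
noncomputable def signature {m : Type*} [Fintype m] [DecidableEq m]
    (M : Matrix m m ℝ) : ℤ :=
  if hM : M.IsHermitian then
    ((Finset.univ.filter fun i => 0 < hM.eigenvalues i).card : ℤ) -
      ((Finset.univ.filter fun i => hM.eigenvalues i < 0).card : ℤ)
  else 0

theorem Matrix.toQuadraticForm'_apply {m : Type*} [Fintype m] [DecidableEq m]
    (A : Matrix m m ℝ) (x : m → ℝ) : A.toQuadraticForm' x = x ⬝ᵥ (A *ᵥ x) := by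
  simp [Matrix.toQuadraticForm', Matrix.toLinearMap₂'_apply']

open QuadraticForm QuadraticMap in
/-- The quadratic form of a real symmetric matrix is equivalent to the sum of squares weighted by
its eigenvalues. -/
theorem Matrix.IsHermitian.equivalent_weightedSumSquares_eigenvalues
    {m : Type*} [Fintype m] [DecidableEq m] {A : Matrix m m ℝ} (hA : A.IsHermitian) :
    Equivalent A.toQuadraticForm' (weightedSumSquares ℝ hA.eigenvalues) := by
  set U := hA.eigenvectorUnitary
  have hdiag : (star U : Matrix m m ℝ) * A * U = diagonal hA.eigenvalues := by
    simpa [Unitary.conjStarAlgAut_apply] using hA.conjStarAlgAut_star_eigenvectorUnitary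
  symm
  refine ⟨{ Matrix.UnitaryGroup.toLinearEquiv U with map_app' := fun x => ?_ }⟩
  change A.toQuadraticForm' (U.1 *ᵥ x) = _
  have key : (U.1 *ᵥ x) ⬝ᵥ (A *ᵥ (U.1 *ᵥ x)) = x ⬝ᵥ (((star U : Matrix m m ℝ) * A * U.1) *ᵥ x) := by
    rw [Matrix.star_eq_conjTranspose, conjTranspose_eq_transpose_of_trivial,
      ← mulVec_mulVec, ← mulVec_mulVec, dotProduct_mulVec x, vecMul_transpose]
  rw [A.toQuadraticForm'_apply, key, hdiag]
  simp only [dotProduct, mulVec_diagonal, weightedSumSquares_apply, smul_eq_mul]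
  exact Finset.sum_congr rfl fun i _ => by ring

theorem Matrix.IsHermitian.sigPos_toQuadraticForm' {m : Type*} [Fintype m] [DecidableEq m]
    {A : Matrix m m ℝ} (hA : A.IsHermitian) :
    sigPos A.toQuadraticForm' = (Finset.univ.filter fun i => 0 < hA.eigenvalues i).card := by
  rw [QuadraticForm.sigPos_of_equiv_weightedSumSquares
    hA.equivalent_weightedSumSquares_eigenvalues, Set.ncard_eq_toFinset_card']
  simp

theorem Matrix.IsHermitian.sigNeg_toQuadraticForm' {m : Type*} [Fintype m] [DecidableEq m]
    {A : Matrix m m ℝ} (hA : A.IsHermitian) :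
    sigNeg A.toQuadraticForm' = (Finset.univ.filter fun i => hA.eigenvalues i < 0).card := by
  rw [QuadraticForm.sigNeg_of_equiv_weightedSumSquares
    hA.equivalent_weightedSumSquares_eigenvalues, Set.ncard_eq_toFinset_card']
  simp

theorem Matrix.IsHermitian.signature_eq {m : Type*} [Fintype m] [DecidableEq m]
    {A : Matrix m m ℝ} (hA : A.IsHermitian) :
    signature A = (sigPos A.toQuadraticForm' : ℤ) - sigNeg A.toQuadraticForm' := by
  rw [signature, dif_pos hA, hA.sigPos_toQuadraticForm', hA.sigNeg_toQuadraticForm']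

theorem Matrix.IsHermitian.eigenvalues_ne_zero_of_det_ne_zero
    {m : Type*} [Fintype m] [DecidableEq m] {A : Matrix m m ℝ} (hA : A.IsHermitian)
    (hdet : A.det ≠ 0) (i : m) : hA.eigenvalues i ≠ 0 := by
  rw [hA.det_eq_prod_eigenvalues] at hdet
  simpa using Finset.prod_ne_zero_iff.mp hdet i (Finset.mem_univ i)

theorem Matrix.IsHermitian.sigPos_add_sigNeg {m : Type*} [Fintype m] [DecidableEq m]
    {A : Matrix m m ℝ} (hA : A.IsHermitian) (hdet : A.det ≠ 0) :
    sigPos A.toQuadraticForm' + sigNeg A.toQuadraticForm' = Fintype.card m := by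
  rw [hA.sigPos_toQuadraticForm', hA.sigNeg_toQuadraticForm', ← Finset.card_univ,
    ← Finset.card_filter_add_card_filter_not (s := Finset.univ) fun i => 0 < hA.eigenvalues i]
  congr 2
  ext i
  simpa using (hA.eigenvalues_ne_zero_of_det_ne_zero hdet i).le_iff_lt.symm

theorem sgn_eq_sign (x : ℝ) : sgn x = (SignType.sign x : ℤ) := by
  unfold sgn
  rcases lt_trichotomy x 0 with h | rfl | h
  · simp [h, h.not_gt]
  · simp
  · simp [h]

/-- The sign of a nonzero determinant of a symmetric matrix is the parity of its negative index. -/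
theorem Matrix.IsHermitian.sgn_det {m : Type*} [Fintype m] [DecidableEq m]
    {A : Matrix m m ℝ} (hA : A.IsHermitian) (hdet : A.det ≠ 0) :
    sgn A.det = (-1) ^ sigNeg A.toQuadraticForm' := by
  have hsign (i : m) : (SignType.sign (hA.eigenvalues i) : ℤ) =
      if hA.eigenvalues i < 0 then -1 else 1 := by
    rcases (hA.eigenvalues_ne_zero_of_det_ne_zero hdet i).lt_or_gt with h | h
    · simp [h]
    · simp [h, h.not_gt]
  have hprod : A.det = ∏ i, hA.eigenvalues i := by simpa using hA.det_eq_prod_eigenvalues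
  have hmap : SignType.sign (∏ i, hA.eigenvalues i) = ∏ i, SignType.sign (hA.eigenvalues i) :=
    map_prod (signHom (α := ℝ)) _ _
  have hcast : ((∏ i, SignType.sign (hA.eigenvalues i) : SignType) : ℤ) =
      ∏ i, (SignType.sign (hA.eigenvalues i) : ℤ) :=
    map_prod (SignType.castHom (α := ℤ)) _ _
  rw [sgn_eq_sign, hprod, hA.sigNeg_toQuadraticForm', hmap, hcast]
  simp_rw [hsign]
  rw [Finset.prod_ite]
  simp

theorem sgn_mul (x y : ℝ) : sgn (x * y) = sgn x * sgn y := by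
  simp [sgn_eq_sign, _root_.sign_mul]

/-- Pulling a quadratic form back along an injective map does not increase its positive index. -/
theorem sigPos_comp_le {V W : Type*} [AddCommGroup V] [Module ℝ V] [FiniteDimensional ℝ V]
    [AddCommGroup W] [Module ℝ W] [FiniteDimensional ℝ W] (Q : QuadraticForm ℝ W)
    (f : V →ₗ[ℝ] W) (hf : Function.Injective f) :
    sigPos (Q.comp f) ≤ sigPos Q := by
  obtain ⟨S, hS, hpos⟩ := exists_finrank_eq_sigPos_and_posDef (Q.comp f)
  rw [← hS, (Submodule.equivMapOfInjective f hf S).finrank_eq]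
  apply le_sigPos_of_posDef
  rintro ⟨_, x, hx, rfl⟩ hne
  exact hpos ⟨x, hx⟩ fun h => hne (by simp_all)

theorem sigNeg_comp_le {V W : Type*} [AddCommGroup V] [Module ℝ V] [FiniteDimensional ℝ V]
    [AddCommGroup W] [Module ℝ W] [FiniteDimensional ℝ W] (Q : QuadraticForm ℝ W)
    (f : V →ₗ[ℝ] W) (hf : Function.Injective f) :
    sigNeg (Q.comp f) ≤ sigNeg Q := by
  have := sigPos_comp_le (-Q) f hf
  rwa [show (-Q).comp f = -Q.comp f from rfl, sigPos_neg, sigPos_neg] at this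

theorem Matrix.toQuadraticForm'_submatrix {m k : Type*} [Fintype m] [DecidableEq m] [Fintype k]
    [DecidableEq k] (A : Matrix m m ℝ) (g : k → m) :
    (A.submatrix g g).toQuadraticForm' =
      A.toQuadraticForm'.comp (Matrix.toLin' ((1 : Matrix m m ℝ).submatrix id g)) := by
  ext x
  simp only [QuadraticMap.comp_apply, Matrix.toQuadraticForm'_apply, Matrix.toLin'_apply]
  have h : A.submatrix g g = ((1 : Matrix m m ℝ).submatrix id g)ᵀ * A *
      (1 : Matrix m m ℝ).submatrix id g := by
    ext i j
    simp [Matrix.mul_apply, Matrix.one_apply]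
  rw [h, ← mulVec_mulVec, ← mulVec_mulVec, dotProduct_mulVec x, vecMul_transpose]

theorem Matrix.toLin'_one_submatrix_injective {m k : Type*} [Fintype m] [DecidableEq m]
    [Fintype k] [DecidableEq k] {g : k → m} (hg : Function.Injective g) :
    Function.Injective (Matrix.toLin' ((1 : Matrix m m ℝ).submatrix id g)) := by
  intro x y h
  ext i
  simpa [Matrix.mulVec, dotProduct, Matrix.one_apply, hg.eq_iff] using congrFun h (g i)

/-- Bordering a nonsingular symmetric matrix to a nonsingular symmetric one changes the signature
by the sign of the product of the determinants. -/
theorem signature_eq_signature_submatrix_add_sgn {n : ℕ}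
    {N : Matrix (Fin (n + 1)) (Fin (n + 1)) ℝ} (hN : N.IsSymm) (hNdet : N.det ≠ 0)
    {M : Matrix (Fin n) (Fin n) ℝ} (hM : M.IsSymm) (hMdet : M.det ≠ 0)
    (hsub : N.submatrix Fin.castSucc Fin.castSucc = M) :
    signature N = signature M + sgn (M.det * N.det) := by
  have hN' : N.IsHermitian := by simpa [Matrix.IsHermitian] using hN.eq
  have hM' : M.IsHermitian := by simpa [Matrix.IsHermitian] using hM.eq
  have hinj := Matrix.toLin'_one_submatrix_injective (Fin.castSucc_injective n)
  have hpos := sigPos_comp_le N.toQuadraticForm' _ hinj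
  have hneg := sigNeg_comp_le N.toQuadraticForm' _ hinj
  rw [← Matrix.toQuadraticForm'_submatrix, hsub] at hpos hneg
  have hMcard := hM'.sigPos_add_sigNeg hMdet
  have hNcard := hN'.sigPos_add_sigNeg hNdet
  rw [Fintype.card_fin] at hMcard hNcard
  rw [sgn_mul, hM'.sgn_det hMdet, hN'.sgn_det hNdet, hM'.signature_eq, hN'.signature_eq]
  obtain h | h : sigNeg N.toQuadraticForm' = sigNeg M.toQuadraticForm' ∨
      sigNeg N.toQuadraticForm' = sigNeg M.toQuadraticForm' + 1 := by lia
  · rw [h, ← mul_pow]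
    simp
    lia
  · rw [h, pow_succ, ← mul_assoc, ← mul_pow]
    simp
    lia

/-- let M⁺, M⁻ be nonsingular symmetric n×n real matrices and N⁺, N⁻
nonsingular symmetric (n+1)×(n+1) real matrices whose leading principal n×n submatrices
are M⁺ and M⁻ respectively, with det(N⁻) = 2·det(M⁻). Then
(σ(M⁺) − σ(M⁻)) − (σ(N⁺) − σ(N⁻)) = 1 − sign(det(M⁺)·det(N⁺)); in particular this
difference equals 0 or 2. -/
theorem signature_diff_formula_typeC {n : ℕ}
    (Mp Mm : Matrix (Fin n) (Fin n) ℝ)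
    (hMp : Mp.IsSymm) (hMm : Mm.IsSymm)
    (hMpdet : Mp.det ≠ 0) (hMmdet : Mm.det ≠ 0)
    (Np Nm : Matrix (Fin (n + 1)) (Fin (n + 1)) ℝ)
    (hNp : Np.IsSymm) (hNm : Nm.IsSymm)
    (hNpdet : Np.det ≠ 0) (hNmdet : Nm.det ≠ 0)
    (hsubp : Np.submatrix Fin.castSucc Fin.castSucc = Mp)
    (hsubm : Nm.submatrix Fin.castSucc Fin.castSucc = Mm)
    (hdet : Nm.det = 2 * Mm.det) :
    (signature Mp - signature Mm) - (signature Np - signature Nm) =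
        1 - sgn (Mp.det * Np.det) ∧
      ((signature Mp - signature Mm) - (signature Np - signature Nm) = 0 ∨
        (signature Mp - signature Mm) - (signature Np - signature Nm) = 2) := by
  have hp := signature_eq_signature_submatrix_add_sgn hNp hNpdet hMp hMpdet hsubp
  have hm := signature_eq_signature_submatrix_add_sgn hNm hNmdet hMm hMmdet hsubm
  have hm_sgn : sgn (Mm.det * Nm.det) = 1 := by
    have : 0 < Mm.det * Nm.det := by rw [hdet]; nlinarith [sq_pos_of_ne_zero hMmdet]
    simp [sgn, this]
  have hdiff : (signature Mp - signature Mm) - (signature Np - signature Nm) =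
      1 - sgn (Mp.det * Np.det) := by lia
  refine ⟨hdiff, ?_⟩
  rcases (mul_ne_zero hMpdet hNpdet).lt_or_gt with h | h
  · right
    simp [hdiff, sgn, h, h.not_gt]
  · left
    simp [hdiff, sgn, h]
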